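/- Let λ, σ ∈ ℝ and let n be an odd positive integer. For h > 0 let M_n(h) := ∫_ℝ (λh + σx)^n dγ_h(x), where γ_h denotes the centered Gaussian measure on ℝ with variance h. Then M_n(h) = O(h^{(n+1)/2}) as h → 0⁺; that is, there exist constants C > 0 and δ > 0 such that |M_n(h)| ≤ C·h^{(n+1)/2} for all h with 0 < h ≤ δ. -/

import Mathlib

open MeasureTheory ProbabilityTheory

open scoped NNReal

lemma integrable_pow_gaussianReal (m : ℝ) (v : ℝ≥0) (n : ℕ) :
    Integrable (fun x : ℝ ↦ x ^ n) (gaussianReal m v) := by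
  have h := (memLp_id_gaussianReal (μ := m) (v := v) (n : ℝ≥0)).integrable_norm_pow'
  refine h.mono' (by fun_prop) (.of_forall fun x ↦ ?_)
  simp

lemma integral_pow_gaussianReal_zero_of_odd (v : ℝ≥0) {n : ℕ} (hn : Odd n) :
    ∫ x, x ^ n ∂(gaussianReal 0 v) = 0 := by
  have h : ∫ x, x ^ n ∂(gaussianReal 0 v) = ∫ x, (-x) ^ n ∂(gaussianReal 0 v) := by
    conv_lhs => rw [← neg_zero, ← gaussianReal_map_neg]
    exact integral_map (by fun_prop) (by fun_prop)
  simp only [hn.neg_pow, integral_neg] at h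
  linarith

/-- Scaling: the moments of the centered Gaussian of variance `s ^ 2`. -/
lemma integral_pow_gaussianReal_zero_sq (s : ℝ) (n : ℕ) :
    ∫ x, x ^ n ∂(gaussianReal 0 (s ^ 2).toNNReal) =
      s ^ n * ∫ x, x ^ n ∂(gaussianReal 0 1) := by
  have h : gaussianReal 0 (s ^ 2).toNNReal = (gaussianReal 0 1).map (s * ·) := by
    rw [gaussianReal_map_const_mul, mul_zero, mul_one, Real.toNNReal_of_nonneg (sq_nonneg s)]
  rw [h, integral_map (by fun_prop) (by fun_prop), ← integral_const_mul]
  simp only [mul_pow]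

/-- Binomial expansion of the moments of an affine function of a centered Gaussian. -/
lemma integral_add_mul_pow_gaussianReal (a σ s : ℝ) (n : ℕ) :
    ∫ x, (a + σ * x) ^ n ∂(gaussianReal 0 (s ^ 2).toNNReal) =
      ∑ k ∈ Finset.range (n + 1), a ^ k * s ^ (n - k) *
        (σ ^ (n - k) * n.choose k * ∫ x, x ^ (n - k) ∂(gaussianReal 0 1)) := by
  have h (x : ℝ) : (a + σ * x) ^ n = ∑ k ∈ Finset.range (n + 1),
      (a ^ k * σ ^ (n - k) * n.choose k) * x ^ (n - k) := by
    rw [add_pow]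
    exact Finset.sum_congr rfl fun k _ ↦ by ring
  simp only [h]
  rw [integral_finsetSum _ fun k _ ↦ (integrable_pow_gaussianReal _ _ _).const_mul _]
  refine Finset.sum_congr rfl fun k _ ↦ ?_
  rw [integral_const_mul, integral_pow_gaussianReal_zero_sq]
  ring

/-- Odd case of Lemma 2: for odd `n`, the `n`-th moment of `λh + σ·N(0,h)` is `O(h^{(n+1)/2})`
as `h → 0⁺`. -/
theorem gaussian_moment_odd_bigO (l σ : ℝ) (n : ℕ) (hn : 0 < n) (hno : Odd n) :
    ∃ C > (0 : ℝ), ∃ δ > (0 : ℝ), ∀ h : ℝ, 0 < h → h ≤ δ →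
      |∫ x : ℝ, (l * h + σ * x) ^ n ∂(gaussianReal 0 h.toNNReal)| ≤ C * h ^ ((n + 1) / 2) := by
  set c : ℕ → ℝ := fun k ↦
    l ^ k * (σ ^ (n - k) * n.choose k * ∫ x, x ^ (n - k) ∂(gaussianReal 0 1)) with hc
  have hsum : 0 ≤ ∑ k ∈ Finset.range (n + 1), |c k| := Finset.sum_nonneg fun _ _ ↦ abs_nonneg _
  refine ⟨∑ k ∈ Finset.range (n + 1), |c k| + 1, by linarith, 1, one_pos, fun h hpos hle ↦ ?_⟩
  obtain ⟨s, hs, rfl⟩ : ∃ s : ℝ, 0 ≤ s ∧ s ^ 2 = h := ⟨√h, Real.sqrt_nonneg h, Real.sq_sqrt hpos.le⟩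
  have hs1 : s ≤ 1 := by nlinarith
  have hexp : (s ^ 2) ^ ((n + 1) / 2) = s ^ (n + 1) := by
    rw [← pow_mul, Nat.two_mul_div_two_of_even hno.add_one]
  have hterm (k : ℕ) (hk : k ∈ Finset.range (n + 1)) :
      |(l * s ^ 2) ^ k * s ^ (n - k) *
        (σ ^ (n - k) * n.choose k * ∫ x, x ^ (n - k) ∂(gaussianReal 0 1))| ≤
      |c k| * s ^ (n + 1) := by
    have hkn : k ≤ n := Nat.lt_succ_iff.mp (Finset.mem_range.mp hk)
    rcases Nat.eq_zero_or_pos k with rfl | hk0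
    · rw [Nat.sub_zero, integral_pow_gaussianReal_zero_of_odd 1 hno, mul_zero, mul_zero, abs_zero]
      positivity
    · have hpow : s ^ (n + k) = (s ^ 2) ^ k * s ^ (n - k) := by
        rw [← pow_mul, ← pow_add]
        congr 1
        omega
      calc _ = |c k * s ^ (n + k)| := by
            rw [hpow, hc]
            ring_nf
        _ = |c k| * s ^ (n + k) := by rw [abs_mul, abs_of_nonneg (pow_nonneg hs _)]
        _ ≤ |c k| * s ^ (n + 1) := by
            gcongr ?_ * ?_
            exact pow_le_pow_of_le_one hs hs1 (by omega)
  rw [integral_add_mul_pow_gaussianReal, hexp]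
  calc _ ≤ ∑ k ∈ Finset.range (n + 1), |c k| * s ^ (n + 1) :=
        (Finset.abs_sum_le_sum_abs _ _).trans (Finset.sum_le_sum hterm)
    _ = (∑ k ∈ Finset.range (n + 1), |c k|) * s ^ (n + 1) := (Finset.sum_mul ..).symm
    _ ≤ _ := by
        gcongr
        linarith
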